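/- Let u : ℝ³ → ℝ be a smooth solution of the 3D Pavlov equation u_yy = u_tx + u_y u_xx − u_x u_xy. Let φ : ℝ³ → ℝ be a smooth solution of the linearized Pavlov equation ℓ_E(φ) = 0, and suppose ψ : ℝ³ → ℝ is a smooth function satisfying the first-order system ∂_t ψ = −u_y ∂_x ψ + u_xy ψ + ∂_y φ and ∂_y ψ = −u_x ∂_x ψ + u_xx ψ + ∂_x φ. Then ψ also satisfies ℓ_E(ψ) = 0. (The system defines a recursion operator R₊ for shadows of symmetries of the Pavlov equation.) -/

import Mathlib

noncomputable section

/-- Partial derivative with respect to the first variable (`x`). -/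
def Dx (f : ℝ → ℝ → ℝ → ℝ) (x y t : ℝ) : ℝ := deriv (fun x' => f x' y t) x

/-- Partial derivative with respect to the second variable (`y`). -/
def Dy (f : ℝ → ℝ → ℝ → ℝ) (x y t : ℝ) : ℝ := deriv (fun y' => f x y' t) y

/-- Partial derivative with respect to the third variable (`t`). -/
def Dt (f : ℝ → ℝ → ℝ → ℝ) (x y t : ℝ) : ℝ := deriv (fun t' => f x y t') t

/-- Smoothness of a function of three real variables `(x, y, t)`. -/
def Smooth3 (f : ℝ → ℝ → ℝ → ℝ) : Prop :=
  ContDiff ℝ (⊤ : ℕ∞) (fun p : ℝ × ℝ × ℝ => f p.1 p.2.1 p.2.2)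

/-- Linearization of the Pavlov equation `u_yy = u_tx + u_y u_xx - u_x u_xy` at a solution `u`. -/
def linPavlov (u φ : ℝ → ℝ → ℝ → ℝ) (x y t : ℝ) : ℝ :=
  Dy (Dy φ) x y t - Dt (Dx φ) x y t - Dy u x y t * Dx (Dx φ) x y t
    + Dx u x y t * Dx (Dy φ) x y t - Dx (Dx u) x y t * Dy φ x y t
    + Dx (Dy u) x y t * Dx φ x y t

open scoped ContDiff

/-- Directional derivatives of a smooth function commute. -/
theorem fderiv_fderiv_apply_comm {E : Type*} [NormedAddCommGroup E] [NormedSpace ℝ E]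
    {F : E → ℝ} (hF : ContDiff ℝ ∞ F) (p v w : E) :
    fderiv ℝ (fun q => fderiv ℝ F q v) p w = fderiv ℝ (fun q => fderiv ℝ F q w) p v := by
  have hd : DifferentiableAt ℝ (fderiv ℝ F) p :=
    (hF.fderiv_right (m := ∞) le_rfl).differentiable (by simp) p
  have hs : IsSymmSndFDerivAt ℝ F p :=
    hF.contDiffAt.isSymmSndFDerivAt (by
      simpa using WithTop.coe_le_coe.2 (le_top : (2 : ℕ∞) ≤ ⊤))
  rw [fderiv_clm_apply hd (differentiableAt_const v),
    fderiv_clm_apply hd (differentiableAt_const w)]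
  simpa using hs.eq w v

/-- A directional derivative of a smooth function is smooth. -/
theorem ContDiff.fderiv_apply_const {E : Type*} [NormedAddCommGroup E] [NormedSpace ℝ E]
    {F : E → ℝ} (hF : ContDiff ℝ ∞ F) (v : E) : ContDiff ℝ ∞ (fun q => fderiv ℝ F q v) :=
  (hF.fderiv_right (m := ∞) le_rfl).clm_apply contDiff_const

namespace Smooth3

variable {f : ℝ → ℝ → ℝ → ℝ}

theorem contDiff (hf : Smooth3 f) :
    ContDiff ℝ ∞ (fun p : ℝ × ℝ × ℝ => f p.1 p.2.1 p.2.2) := hf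

theorem hasDerivAt_x_fderiv (hf : Smooth3 f) (x y t : ℝ) :
    HasDerivAt (fun s => f s y t)
      (fderiv ℝ (fun p : ℝ × ℝ × ℝ => f p.1 p.2.1 p.2.2) (x, y, t) (1, 0, 0)) x := by
  have hc : HasDerivAt (fun s : ℝ => ((s, y, t) : ℝ × ℝ × ℝ)) (1, 0, 0) x :=
    (hasDerivAt_id x).prodMk (hasDerivAt_const x (y, t))
  exact (hf.contDiff.differentiable (by simp) (x, y, t)).hasFDerivAt.comp_hasDerivAt x hc

theorem Dx_eq (hf : Smooth3 f) (x y t : ℝ) :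
    Dx f x y t = fderiv ℝ (fun p : ℝ × ℝ × ℝ => f p.1 p.2.1 p.2.2) (x, y, t) (1, 0, 0) :=
  (hf.hasDerivAt_x_fderiv x y t).deriv

theorem hasDerivAt_x (hf : Smooth3 f) (x y t : ℝ) :
    HasDerivAt (fun s => f s y t) (Dx f x y t) x :=
  (hf.hasDerivAt_x_fderiv x y t).differentiableAt.hasDerivAt

theorem smooth_Dx (hf : Smooth3 f) : Smooth3 (Dx f) := by
  simpa only [Smooth3, hf.Dx_eq] using hf.contDiff.fderiv_apply_const (1, 0, 0)

theorem hasDerivAt_y_fderiv (hf : Smooth3 f) (x y t : ℝ) :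
    HasDerivAt (fun s => f x s t)
      (fderiv ℝ (fun p : ℝ × ℝ × ℝ => f p.1 p.2.1 p.2.2) (x, y, t) (0, 1, 0)) y := by
  have hc : HasDerivAt (fun s : ℝ => ((x, s, t) : ℝ × ℝ × ℝ)) (0, 1, 0) y :=
    (hasDerivAt_const y x).prodMk ((hasDerivAt_id y).prodMk (hasDerivAt_const y t))
  exact (hf.contDiff.differentiable (by simp) (x, y, t)).hasFDerivAt.comp_hasDerivAt y hc

theorem Dy_eq (hf : Smooth3 f) (x y t : ℝ) :
    Dy f x y t = fderiv ℝ (fun p : ℝ × ℝ × ℝ => f p.1 p.2.1 p.2.2) (x, y, t) (0, 1, 0) :=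
  (hf.hasDerivAt_y_fderiv x y t).deriv

theorem hasDerivAt_y (hf : Smooth3 f) (x y t : ℝ) :
    HasDerivAt (fun s => f x s t) (Dy f x y t) y :=
  (hf.hasDerivAt_y_fderiv x y t).differentiableAt.hasDerivAt

theorem smooth_Dy (hf : Smooth3 f) : Smooth3 (Dy f) := by
  simpa only [Smooth3, hf.Dy_eq] using hf.contDiff.fderiv_apply_const (0, 1, 0)

theorem hasDerivAt_t_fderiv (hf : Smooth3 f) (x y t : ℝ) :
    HasDerivAt (fun s => f x y s)
      (fderiv ℝ (fun p : ℝ × ℝ × ℝ => f p.1 p.2.1 p.2.2) (x, y, t) (0, 0, 1)) t := by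
  have hc : HasDerivAt (fun s : ℝ => ((x, y, s) : ℝ × ℝ × ℝ)) (0, 0, 1) t :=
    (hasDerivAt_const t x).prodMk ((hasDerivAt_const t y).prodMk (hasDerivAt_id t))
  exact (hf.contDiff.differentiable (by simp) (x, y, t)).hasFDerivAt.comp_hasDerivAt t hc

theorem Dt_eq (hf : Smooth3 f) (x y t : ℝ) :
    Dt f x y t = fderiv ℝ (fun p : ℝ × ℝ × ℝ => f p.1 p.2.1 p.2.2) (x, y, t) (0, 0, 1) :=
  (hf.hasDerivAt_t_fderiv x y t).deriv

theorem smooth_Dt (hf : Smooth3 f) : Smooth3 (Dt f) := by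
  simpa only [Smooth3, hf.Dt_eq] using hf.contDiff.fderiv_apply_const (0, 0, 1)

theorem Dy_Dx (hf : Smooth3 f) (x y t : ℝ) :
    Dy (Dx f) x y t = Dx (Dy f) x y t := by
  simp only [hf.smooth_Dx.Dy_eq, hf.smooth_Dy.Dx_eq, hf.Dx_eq, hf.Dy_eq]
  exact fderiv_fderiv_apply_comm hf.contDiff (x, y, t) (1, 0, 0) (0, 1, 0)

theorem Dt_Dx (hf : Smooth3 f) (x y t : ℝ) :
    Dt (Dx f) x y t = Dx (Dt f) x y t := by
  simp only [hf.smooth_Dx.Dt_eq, hf.smooth_Dt.Dx_eq, hf.Dx_eq, hf.Dt_eq]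
  exact fderiv_fderiv_apply_comm hf.contDiff (x, y, t) (1, 0, 0) (0, 0, 1)

end Smooth3

/-- The direct recursion operator `R₊` of the Pavlov equation maps shadows to shadows. -/
theorem pavlov_recursion_plus
    (u : ℝ → ℝ → ℝ → ℝ) (hu : Smooth3 u)
    (husol : ∀ x y t : ℝ, Dy (Dy u) x y t = Dt (Dx u) x y t + Dy u x y t * Dx (Dx u) x y t - Dx u x y t * Dx (Dy u) x y t)
    (φ : ℝ → ℝ → ℝ → ℝ) (hφ : Smooth3 φ)
    (hφsh : ∀ x y t : ℝ, linPavlov u φ x y t = 0)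
    (ψ : ℝ → ℝ → ℝ → ℝ) (hψ : Smooth3 ψ)
    (hsys_t : ∀ x y t : ℝ,
      Dt ψ x y t = -Dy u x y t * Dx ψ x y t + Dx (Dy u) x y t * ψ x y t + Dy φ x y t)
    (hsys_y : ∀ x y t : ℝ,
      Dy ψ x y t = -Dx u x y t * Dx ψ x y t + Dx (Dx u) x y t * ψ x y t + Dx φ x y t) :
    ∀ x y t : ℝ, linPavlov u ψ x y t = 0 := by
  intro x y t
  have hyy : Dy (Dy ψ) x y t =
      -(Dy (Dx u) x y t * Dx ψ x y t + Dx u x y t * Dy (Dx ψ) x y t)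
        + (Dy (Dx (Dx u)) x y t * ψ x y t + Dx (Dx u) x y t * Dy ψ x y t)
        + Dy (Dx φ) x y t := by
    have h := (((hu.smooth_Dx.hasDerivAt_y x y t).mul (hψ.smooth_Dx.hasDerivAt_y x y t)).neg.add
      ((hu.smooth_Dx.smooth_Dx.hasDerivAt_y x y t).mul (hψ.hasDerivAt_y x y t))).add (hφ.smooth_Dx.hasDerivAt_y x y t)
    refine (h.congr_of_eventuallyEq (.of_forall fun s => ?_)).deriv
    simp [hsys_y]
  have htx : Dx (Dt ψ) x y t =
      -(Dx (Dy u) x y t * Dx ψ x y t + Dy u x y t * Dx (Dx ψ) x y t)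
        + (Dx (Dx (Dy u)) x y t * ψ x y t + Dx (Dy u) x y t * Dx ψ x y t)
        + Dx (Dy φ) x y t := by
    have h := (((hu.smooth_Dy.hasDerivAt_x x y t).mul (hψ.smooth_Dx.hasDerivAt_x x y t)).neg.add
      ((hu.smooth_Dy.smooth_Dx.hasDerivAt_x x y t).mul (hψ.hasDerivAt_x x y t))).add (hφ.smooth_Dy.hasDerivAt_x x y t)
    refine (h.congr_of_eventuallyEq (.of_forall fun s => ?_)).deriv
    simp [hsys_t]
  have huxy : Dy (Dx u) = Dx (Dy u) := by
    funext a b c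
    exact hu.Dy_Dx a b c
  rw [linPavlov, hψ.Dt_Dx, hyy, htx, hu.smooth_Dx.Dy_Dx, huxy, hψ.Dy_Dx, hφ.Dy_Dx]
  ring
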